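/- arXiv:1210.8396 — 2 statements merged into one kernel-verified Lean document; each statement's English description precedes it below -/
import Mathlib

section
/- Let X → Y be an affine immersion of schemes with Y locally noetherian, let X̄ be the schematic closure of X in Y, and suppose X̄ \ X is nonempty. Then every irreducible component Z of X̄ \ X has codimension exactly 1 in X̄. -/
section algebra

variable {A : Type*} [CommRing A] [IsLocalRing A] [IsNoetherianRing A]

open IsLocalRing

theorem isArtinianRing_quotient_maximalIdeal_pow (k : ℕ) :
    IsArtinianRing (A ⧸ maximalIdeal A ^ k) := by
  have : Ring.KrullDimLE 0 (A ⧸ maximalIdeal A ^ k) := by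
    refine Ring.krullDimLE_zero_iff.mpr fun P hP ↦ ?_
    have hc : (P.comap (Ideal.Quotient.mk (maximalIdeal A ^ k))).IsPrime := hP.comap _
    have hle : maximalIdeal A ^ k ≤ P.comap (Ideal.Quotient.mk (maximalIdeal A ^ k)) :=
      .trans (by simp) (Ideal.ker_le_comap _)
    have heq := (maximalIdeal.isMaximal A).eq_of_le hc.ne_top (hc.le_of_pow_le hle)
    refine Ideal.isMaximal_of_isIntegral_of_isMaximal_comap
      (R := A) P ?_
    convert! maximalIdeal.isMaximal A
    exact heq.symm
  exact IsNoetherianRing.isArtinianRing_of_krullDimLE_zero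

theorem isArtinian_of_isNoetherian_of_maximalIdeal_pow_smul {N : Type*} [AddCommGroup N]
    [Module A N] [IsNoetherian A N] {k : ℕ}
    (hk : ∀ a ∈ maximalIdeal A ^ k, ∀ u : N, a • u = 0) : IsArtinian A N := by
  have ht : Module.IsTorsionBySet A N (maximalIdeal A ^ k : Ideal A) := fun u a ↦ hk _ a.2 u
  let _ := ht.module
  have := isArtinianRing_quotient_maximalIdeal_pow (A := A) k
  have : Module.Finite (A ⧸ maximalIdeal A ^ k) N :=
    (ht.semilinearMap.finite_iff_of_bijective Function.bijective_id).mp inferInstance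
  exact (ht.semilinearMap.isArtinian_iff_of_bijective Function.bijective_id).mpr inferInstance

theorem exists_maximalIdeal_pow_smul_eq_zero {N : Type*} [AddCommGroup N]
    [Module A N] [IsNoetherian A N]
    (h : ∀ a ∈ maximalIdeal A, ∀ u : N, ∃ n : ℕ, a ^ n • u = 0) :
    ∃ k : ℕ, ∀ a ∈ maximalIdeal A ^ k, ∀ u : N, a • u = 0 := by
  have hle : maximalIdeal A ≤ (Module.annihilator A N).radical := by
    intro a ha
    obtain ⟨n, hn⟩ := monotone_stabilizes_iff_noetherian.mpr ‹IsNoetherian A N›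
      ⟨fun n ↦ Submodule.torsionBy A N (a ^ n), fun i j hij u hu ↦ by
        obtain ⟨c, rfl⟩ := Nat.exists_eq_add_of_le hij
        rw [Submodule.mem_torsionBy_iff] at hu ⊢
        rw [pow_add, mul_comm, mul_smul, hu, smul_zero]⟩
    refine ⟨n, Module.mem_annihilator.mpr fun u ↦ ?_⟩
    obtain ⟨l, hl⟩ := h a ha u
    have hu : u ∈ Submodule.torsionBy A N (a ^ (n + l)) := by
      rw [Submodule.mem_torsionBy_iff, pow_add, mul_smul, hl, smul_zero]
    have := hn (n + l) (Nat.le_add_right _ _)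
    exact (Submodule.mem_torsionBy_iff _ _).mp (this.ge hu)
  obtain ⟨k, hk⟩ := Ideal.exists_pow_le_of_le_radical_of_fg hle (IsNoetherian.noetherian _)
  exact ⟨k, fun a ha u ↦ Module.mem_annihilator.mp (hk ha) u⟩

/-- For an `x`-power torsion module whose `x`-torsion is artinian, the chain of submodules
`x ^ n • M` is stationary. -/
theorem exists_forall_pow_smul_eq_pow_succ_smul {A M : Type*} [CommRing A] [AddCommGroup M]
    [Module A M] (x : A) [IsArtinian A (Submodule.torsionBy A M x)]
    (htors : ∀ u : M, ∃ n : ℕ, x ^ n • u = 0) :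
    ∃ N : ℕ, ∀ u : M, ∃ v : M, x ^ N • u = x ^ (N + 1) • v := by
  let T : ℕ → Submodule A M := fun n ↦ LinearMap.range (LinearMap.lsmul A M (x ^ n))
  have hT : ∀ n u, u ∈ T n ↔ ∃ v, x ^ n • v = u := fun n u ↦ Iff.rfl
  obtain ⟨N, hN⟩ := IsArtinian.monotone_stabilizes (R := A)
    (M := Submodule.torsionBy A M x)
    ⟨fun n ↦ OrderDual.toDual ((T n).comap (Submodule.torsionBy A M x).subtype),
      fun i j hij u hu ↦ by
        obtain ⟨c, rfl⟩ := Nat.exists_eq_add_of_le hij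
        obtain ⟨v, hv⟩ := (hT _ _).mp hu
        exact (hT _ _).mpr ⟨x ^ c • v, by rw [smul_smul, ← pow_add, hv]⟩⟩
  have hmem : ∀ n, N ≤ n → ∀ u, x • u = 0 → u ∈ T N → u ∈ T n := fun n hn u hu huN ↦ by
    have := hN n hn
    have h2 : (⟨u, (Submodule.mem_torsionBy_iff _ _).mpr hu⟩ : Submodule.torsionBy A M x) ∈
      (T N).comap (Submodule.torsionBy A M x).subtype := huN
    exact (show (T N).comap (Submodule.torsionBy A M x).subtype =
      (T n).comap (Submodule.torsionBy A M x).subtype from this).le h2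
  have key : ∀ k : ℕ, ∀ u ∈ T N, x ^ k • u = 0 → u ∈ T (N + 1) := by
    intro k
    induction k with
    | zero =>
      intro u _ hu
      rw [pow_zero, one_smul] at hu
      exact hu ▸ zero_mem _
    | succ k ih =>
      intro u huN hu
      have h1 : x ^ k • u ∈ T (N + k + 1) := by
        refine hmem _ (by omega) _ (by rw [smul_smul, ← pow_succ', hu]) ?_
        exact Submodule.smul_mem _ _ huN
      obtain ⟨v, hv⟩ := (hT _ _).mp h1
      have h2 : x ^ (N + 1) • v ∈ T (N + 1) := ⟨v, rfl⟩
      have h3 : x ^ (N + 1) • v ∈ T N := ⟨x • v, by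
        rw [LinearMap.lsmul_apply, smul_smul, ← pow_succ]⟩
      have h4 := ih (u - x ^ (N + 1) • v) (sub_mem huN h3) (by
        rw [smul_sub, ← hv, smul_smul, ← pow_add, sub_eq_zero]; congr 2; ring)
      simpa using add_mem h4 h2
  refine ⟨N, fun u ↦ ?_⟩
  obtain ⟨n, hn⟩ := htors u
  obtain ⟨v, hv⟩ := (hT _ _).mp <| key n (x ^ N • u) ⟨u, rfl⟩ (by rw [smul_comm, hn, smul_zero])
  exact ⟨v, hv.symm⟩

theorem exists_eq_smul_of_maximalIdeal_smul_top_eq_top {M : Type*} [AddCommGroup M] [Module A M]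
    (hM : maximalIdeal A • (⊤ : Submodule A M) = ⊤)
    (htors : ∀ a ∈ maximalIdeal A, ∀ u : M, ∃ n : ℕ, a ^ n • u = 0)
    {x : A} (hx : x ∈ maximalIdeal A) [IsNoetherian A (Submodule.torsionBy A M x)] (u : M) :
    ∃ v : M, u = x • v := by
  obtain ⟨k, hk⟩ := exists_maximalIdeal_pow_smul_eq_zero (A := A)
    (N := Submodule.torsionBy A M x) fun a ha u ↦ by
      obtain ⟨n, hn⟩ := htors a ha u
      exact ⟨n, Subtype.ext hn⟩
  have := isArtinian_of_isNoetherian_of_maximalIdeal_pow_smul hk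
  obtain ⟨N, hN⟩ := exists_forall_pow_smul_eq_pow_succ_smul x (htors x hx)
  have hkill : ∀ n : ℕ, ∀ w : M, x ^ n • w = 0 → ∀ a ∈ maximalIdeal A ^ (k * n), a • w = 0 := by
    intro n
    induction n with
    | zero =>
      intro w hw a _
      rw [pow_zero, one_smul] at hw
      rw [hw, smul_zero]
    | succ n ih =>
      intro w hw a ha
      rw [mul_add, mul_one, pow_add] at ha
      refine Submodule.mul_induction_on ha (fun b hb c hc ↦ ?_)
        (fun b c hb hc ↦ by rw [add_smul, hb, hc, add_zero])
      rw [mul_smul]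
      refine ih (c • w) ?_ b hb
      have := hk c hc ⟨x ^ n • w, by
        rw [Submodule.mem_torsionBy_iff, smul_smul, ← pow_succ', hw]⟩
      rw [smul_comm]
      exact congrArg Subtype.val this
  have hpow : ∀ n : ℕ, maximalIdeal A ^ n • (⊤ : Submodule A M) = ⊤ := by
    intro n
    induction n with
    | zero => simp
    | succ n ih => rw [pow_succ, Submodule.mul_smul, hM, ih]
  have hmem : u ∈ maximalIdeal A ^ (k * N) • (⊤ : Submodule A M) := by
    rw [hpow]; exact Submodule.mem_top
  suffices maximalIdeal A ^ (k * N) • (⊤ : Submodule A M) ≤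
      LinearMap.range (LinearMap.lsmul A M x) by
    obtain ⟨v, hv⟩ := this hmem
    exact ⟨v, hv.symm⟩
  refine Submodule.smul_le.mpr fun a ha w _ ↦ ?_
  obtain ⟨v, hv⟩ := hN w
  have h0 := hkill N (w - x • v) (by rw [smul_sub, hv, smul_smul, ← pow_succ, sub_self]) a ha
  refine ⟨a • v, ?_⟩
  rw [smul_sub, sub_eq_zero] at h0
  rw [h0, LinearMap.lsmul_apply, smul_comm]

theorem isUnit_algebraMap_of_map_maximalIdeal_eq_top {B : Type*} [CommRing B] [IsDomain B]
    [Algebra A B] (hB : (maximalIdeal A).map (algebraMap A B) = ⊤)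
    (htors : ∀ a ∈ maximalIdeal A, ∀ b : B, ∃ n : ℕ, ∃ c : A,
      algebraMap A B a ^ n * b = algebraMap A B c)
    {x : A} (hx : x ∈ maximalIdeal A) (hx0 : algebraMap A B x ≠ 0) :
    IsUnit (algebraMap A B x) := by
  let A₀ : Submodule A B := LinearMap.range (Algebra.linearMap A B)
  have hB' : maximalIdeal A • (⊤ : Submodule A B) = ⊤ := by
    rw [Ideal.smul_top_eq_map, hB]; rfl
  have hM : maximalIdeal A • (⊤ : Submodule A (B ⧸ A₀)) = ⊤ := by
    have := congrArg (Submodule.map A₀.mkQ) hB'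
    rwa [Submodule.map_smul'', Submodule.map_top, Submodule.range_mkQ] at this
  let P : Submodule A B := A₀.comap (LinearMap.lsmul A B x)
  have : IsNoetherian A P := by
    have : IsNoetherian A A₀ := by
      exact isNoetherian_of_surjective (M := A) (Algebra.linearMap A B).rangeRestrict
        (LinearMap.range_rangeRestrict _)
    refine isNoetherian_of_injective ((LinearMap.lsmul A B x).restrict (p := P) (q := A₀)
      fun b hb ↦ hb) fun b c h ↦ ?_
    have h' : x • (b : B) = x • (c : B) := congrArg Subtype.val h
    rw [Algebra.smul_def, Algebra.smul_def] at h'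
    exact Subtype.ext (mul_left_cancel₀ hx0 h')
  have : IsNoetherian A (Submodule.torsionBy A (B ⧸ A₀) x) := by
    refine isNoetherian_of_surjective (M := P) (A₀.mkQ.restrict (p := P)
      (q := Submodule.torsionBy A (B ⧸ A₀) x) fun b hb ↦ ?_) (LinearMap.range_eq_top.mpr ?_)
    · rw [Submodule.mem_torsionBy_iff, ← map_smul]
      exact (Submodule.Quotient.mk_eq_zero _).mpr hb
    · rintro ⟨u, hu⟩
      obtain ⟨b, rfl⟩ := A₀.mkQ_surjective u
      rw [Submodule.mem_torsionBy_iff, ← map_smul] at hu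
      exact ⟨⟨b, (Submodule.Quotient.mk_eq_zero A₀).mp hu⟩, rfl⟩
  have hdiv := exists_eq_smul_of_maximalIdeal_smul_top_eq_top hM (fun a ha u ↦ by
    obtain ⟨b, rfl⟩ := A₀.mkQ_surjective u
    obtain ⟨n, c, hc⟩ := htors a ha b
    refine ⟨n, ?_⟩
    rw [← map_smul]
    exact (Submodule.Quotient.mk_eq_zero _).mpr
      ⟨c, by rw [Algebra.smul_def, map_pow, hc]; rfl⟩) hx
  have hle : maximalIdeal A • (⊤ : Submodule A B) ≤
      Submodule.map (Algebra.linearMap A B) (maximalIdeal A) ⊔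
        LinearMap.range (LinearMap.lsmul A B x) := by
    refine Submodule.smul_le.mpr fun a ha b _ ↦ ?_
    obtain ⟨v, hv⟩ := hdiv (A₀.mkQ b)
    obtain ⟨c, rfl⟩ := A₀.mkQ_surjective v
    rw [← map_smul, ← sub_eq_zero, ← map_sub] at hv
    obtain ⟨d, hd⟩ := (Submodule.Quotient.mk_eq_zero _).mp hv
    refine Submodule.mem_sup.mpr ⟨algebraMap A B (a * d), ⟨a * d, Ideal.mul_mem_right _ _ ha, rfl⟩,
      x • a • c, ⟨a • c, rfl⟩, ?_⟩
    rw [Algebra.linearMap_apply] at hd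
    rw [map_mul, hd, smul_comm, ← Algebra.smul_def, smul_sub, sub_add_cancel]
  rw [hB'] at hle
  obtain ⟨_, ⟨a, ha, rfl⟩, _, ⟨c, rfl⟩, h⟩ :=
    Submodule.mem_sup.mp (hle (Submodule.mem_top (x := 1)))
  have hu : IsUnit (1 - a) := by
    by_contra hn
    exact (maximalIdeal.isMaximal A).ne_top
      ((Ideal.eq_top_iff_one _).mpr (by simpa using add_mem ((mem_maximalIdeal _).mpr hn) ha))
  refine isUnit_of_dvd_unit ⟨c, ?_⟩ (hu.map (algebraMap A B))
  rw [map_sub, map_one, sub_eq_iff_eq_add', ← h]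
  simp [Algebra.smul_def]

end algebra

namespace AlgebraicGeometry

open CategoryTheory IsLocalRing

universe u

theorem surjective_of_isClosedImmersion_SpecMap {A B : CommRingCat.{u}} (φ : A ⟶ B)
    [IsClosedImmersion (Spec.map φ)] : Function.Surjective φ := by
  intro b
  obtain ⟨c, hc⟩ := (Spec.map φ).app_surjective ⊤ (isAffineOpen_top _)
    ((Scheme.ΓSpecIso B).inv b)
  refine ⟨(Scheme.ΓSpecIso A).hom c, ?_⟩
  have h := congr($(Scheme.ΓSpecIso_naturality φ) c)
  simp only [CommRingCat.comp_apply] at h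
  rw [← h]
  exact (congrArg (Scheme.ΓSpecIso B).hom hc).trans (by simp)

theorem awayMap_surjective_of_isPreimmersion {A B : CommRingCat.{u}} (φ : A ⟶ B)
    [IsPreimmersion (Spec.map φ)] {K : Set (Spec A)} (hK : IsClosed K) (a : A)
    (h : ∀ y ∈ PrimeSpectrum.basicOpen a, y ∈ Set.range (Spec.map φ) ↔ y ∈ K) :
    Function.Surjective (Localization.awayMap φ.hom a) := by
  let U : (Spec A).Opens := PrimeSpectrum.basicOpen a
  have : IsClosedImmersion (Spec.map φ ∣_ U) := by
    refine IsClosedImmersion.of_isPreimmersion _ ?_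
    rw [morphismRestrict_base]
    erw [Set.range_restrictPreimage]
    rw [show Subtype.val ⁻¹' Set.range (Spec.map φ) = (Subtype.val ⁻¹' K : Set U.1) from
      Set.ext fun y ↦ h y.1 y.2]
    exact hK.preimage continuous_subtype_val
  have : IsClosedImmersion (Spec.map <| CommRingCat.ofHom (Localization.awayMap φ.hom a)) :=
    (MorphismProperty.arrow_mk_iso_iff @IsClosedImmersion
      (SpecMapRestrictBasicOpenIso φ a)).mp this
  exact surjective_of_isClosedImmersion_SpecMap
    (CommRingCat.ofHom (Localization.awayMap φ.hom a))

/-- If the punctured spectrum of a closed subset of a noetherian local scheme is the image of an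
affine immersion, then it contains no nontrivial specialization. -/
theorem eq_of_specializes_of_range_eq_diff_closedPoint {A B : CommRingCat.{u}} [IsLocalRing A]
    [IsNoetherianRing A] (φ : A ⟶ B) [IsPreimmersion (Spec.map φ)] {K : Set (Spec A)}
    (hK : IsClosed K) (hr : Set.range (Spec.map φ) = K \ {closedPoint A}) {Q P : Spec B}
    (hQP : Spec.map φ Q ⤳ Spec.map φ P) : Q = P := by
  have hle : Q.asIdeal ≤ P.asIdeal :=
    (PrimeSpectrum.le_iff_specializes Q P).mpr
      ((Spec.map φ).isEmbedding.isInducing.specializes_iff.mp hQP)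
  by_contra hne
  have hPQ : ¬ Spec.map φ P ⤳ Spec.map φ Q := fun h ↦ hne
    ((Spec.map φ).isEmbedding.injective (hQP.antisymm h).eq)
  obtain ⟨x, hxP, hxQ⟩ : ∃ x : A, φ x ∈ P.asIdeal ∧ φ x ∉ Q.asIdeal := by
    by_contra! hcon
    exact hPQ ((PrimeSpectrum.le_iff_specializes (Spec.map φ P) (Spec.map φ Q)).mp hcon)
  have hclosed : ∀ a ∈ maximalIdeal A, ∀ y ∈ PrimeSpectrum.basicOpen a,
      y ∈ Set.range (Spec.map φ) ↔ y ∈ K := fun a ha y hy ↦ by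
    rw [hr]
    refine ⟨fun h ↦ h.1, fun h ↦ ⟨h, ?_⟩⟩
    rintro rfl
    exact hy ha
  have hmap : (maximalIdeal A).map φ.hom = ⊤ := by
    by_contra hcon
    obtain ⟨M, hM, hle⟩ := Ideal.exists_le_maximal _ hcon
    have h1 : Spec.map φ ⟨M, hM.isPrime⟩ ∈ K \ {closedPoint A} := hr ▸ ⟨_, rfl⟩
    refine h1.2 (PrimeSpectrum.ext ?_)
    exact ((maximalIdeal.isMaximal A).eq_of_le (Ideal.IsPrime.ne_top (hM.isPrime.comap φ.hom))
      (Ideal.map_le_iff_le_comap.mp hle)).symm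
  have : Q.asIdeal.IsPrime := Q.isPrime
  have : P.asIdeal.IsPrime := P.isPrime
  algebraize [(Ideal.Quotient.mk Q.asIdeal).comp φ.hom]
  have halg : ∀ c : A, algebraMap A (B ⧸ Q.asIdeal) c = Ideal.Quotient.mk Q.asIdeal (φ c) :=
    fun _ ↦ rfl
  have hxm : x ∈ maximalIdeal A :=
    le_maximalIdeal (Ideal.IsPrime.ne_top (P.isPrime.comap φ.hom)) hxP
  have hu : IsUnit (algebraMap A (B ⧸ Q.asIdeal) x) := by
    refine isUnit_algebraMap_of_map_maximalIdeal_eq_top ?_ (fun a ha b ↦ ?_) hxm ?_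
    · have := congrArg (Ideal.map (Ideal.Quotient.mk Q.asIdeal)) hmap
      rwa [Ideal.map_map, Ideal.map_top] at this
    · obtain ⟨b, rfl⟩ := Ideal.Quotient.mk_surjective b
      obtain ⟨c, n, hc⟩ := Localization.awayMap_surjective_iff.mp
        (awayMap_surjective_of_isPreimmersion φ hK a (hclosed a ha)) b
      exact ⟨n, c, by rw [halg, halg, ← map_pow, ← map_mul]; exact congrArg _ hc.symm⟩
    · rwa [halg, Ne, Ideal.Quotient.eq_zero_iff_mem]
  have := hu.map (Ideal.Quotient.factor hle)
  rw [halg, Ideal.Quotient.factor_mk, Ideal.Quotient.eq_zero_iff_mem.mpr hxP] at this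
  exact not_isUnit_zero this

end AlgebraicGeometry

/-- A point in the closure of a subset of a space, admitting a noetherian neighbourhood, lies in
the closure of an irreducible subset of it. -/
theorem exists_isIrreducible_subset_of_mem_closure {Y : Type*} [TopologicalSpace Y] {S U : Set Y}
    [TopologicalSpace.NoetherianSpace U] (hU : IsOpen U) {z : Y} (hzU : z ∈ U)
    (hz : z ∈ closure S) : ∃ T ⊆ S, IsIrreducible T ∧ z ∈ closure T := by
  have : TopologicalSpace.NoetherianSpace ↥(S ∩ U) :=
    TopologicalSpace.NoetherianSpace.inter_of_right _ _
  obtain ⟨F, hF, -, hirr, huniv⟩ :=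
    TopologicalSpace.NoetherianSpace.exists_finite_set_isClosed_irreducible
      (isClosed_univ (X := ↥(S ∩ U)))
  have hz' : z ∈ closure (S ∩ U) := by
    rw [Set.inter_comm]
    exact hU.inter_closure ⟨hzU, hz⟩
  have hSU : S ∩ U = ⋃ t ∈ F, Subtype.val '' t := by
    rw [← Set.image_iUnion₂, ← Set.sUnion_eq_biUnion, ← huniv, Set.image_univ, Subtype.range_coe]
  rw [hSU, hF.closure_biUnion] at hz'
  obtain ⟨t, ht, hzt⟩ := Set.mem_iUnion₂.mp hz'
  exact ⟨Subtype.val '' t, fun _ ⟨y, _, hy⟩ ↦ hy ▸ y.2.1,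
    (hirr t ht).image _ continuous_subtype_val.continuousOn, hzt⟩

namespace AlgebraicGeometry

open CategoryTheory IsLocalRing TopologicalSpace

universe u

theorem IsLocallyNoetherian.exists_isOpen_noetherianSpace {Y : Scheme.{u}} [IsLocallyNoetherian Y]
    (z : Y) : ∃ U : Set Y, IsOpen U ∧ z ∈ U ∧ NoetherianSpace U := by
  obtain ⟨U, hU, hz, -⟩ := exists_isAffineOpen_mem_and_subset (U := ⊤) (x := z) trivial
  have := IsLocallyNoetherian.component_noetherian ⟨U, hU⟩
  exact ⟨U, U.2, hz, noetherianSpace_of_isAffineOpen U hU⟩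

/-- If `z` is a generic point of the boundary of an affine immersion `f` into a locally noetherian
scheme, then there are no nontrivial specializations between generizations of `z` in the image
of `f`. -/
theorem eq_of_specializes_of_isAffineHom_of_isImmersion {X Y : Scheme.{u}} (f : X ⟶ Y)
    [IsImmersion f] [IsAffineHom f] [IsLocallyNoetherian Y] {z : Y}
    (hz : z ∉ Set.range f)
    (hmin : ∀ y ∈ closure (Set.range f) \ Set.range f, y ⤳ z → y = z)
    {w w' : X} (hw : f w ⤳ z) (hw' : f w' ⤳ f w) : w' = w := by
  let i := Y.fromSpecStalk z
  let g := Limits.pullback.snd f i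
  have : IsAffine (Limits.pullback f i) := isAffine_of_isAffineHom g
  let g' := (Limits.pullback f i).isoSpec.inv ≫ g
  let φ := Spec.preimage g'
  have hφ : Spec.map φ = g' := Spec.map_preimage g'
  have hrange : Set.range (Spec.map φ) = i ⁻¹' Set.range f := by
    rw [hφ, ← Scheme.Pullback.range_snd]
    simp only [g', Scheme.Hom.comp_base, TopCat.hom_comp, ContinuousMap.coe_comp]
    erw [Set.range_comp, Set.range_eq_univ.mpr (Limits.pullback f i).isoSpec.inv.surjective]
    exact Set.image_univ
  have : IsPreimmersion (Spec.map φ) := by rw [hφ]; infer_instance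
  have hi : i (closedPoint (Y.presheaf.stalk z)) = z := Scheme.fromSpecStalk_closedPoint
  have hirange : ∀ y, y ⤳ z → ∃ p, i p = y := fun y hy ↦ by
    have : y ∈ Set.range i := by rw [Scheme.range_fromSpecStalk]; exact hy
    exact this
  have hr : Set.range (Spec.map φ) =
      i ⁻¹' closure (Set.range f) \ {closedPoint (Y.presheaf.stalk z)} := by
    rw [hrange]
    ext p
    refine ⟨fun hp ↦ ⟨subset_closure hp, ?_⟩, fun ⟨hp, hpz⟩ ↦ ?_⟩
    · rintro rfl
      exact hz (hi ▸ hp)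
    · by_contra hcon
      refine hpz (i.isEmbedding.injective ((hmin _ ⟨hp, hcon⟩ ?_).trans hi.symm))
      have : i p ∈ Set.range i := ⟨p, rfl⟩
      rwa [Scheme.range_fromSpecStalk] at this
  obtain ⟨p, hp⟩ := hirange _ hw
  obtain ⟨p', hp'⟩ := hirange _ (hw'.trans hw)
  obtain ⟨P, rfl⟩ : p ∈ Set.range (Spec.map φ) := by rw [hrange]; exact ⟨w, hp.symm⟩
  obtain ⟨Q, rfl⟩ : p' ∈ Set.range (Spec.map φ) := by rw [hrange]; exact ⟨w', hp'.symm⟩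
  have hQP : Spec.map φ Q ⤳ Spec.map φ P := by
    rw [← i.isEmbedding.isInducing.specializes_iff, hp, hp']
    exact hw'
  have := eq_of_specializes_of_range_eq_diff_closedPoint φ
    (isClosed_closure.preimage i.continuous) hr hQP
  subst this
  exact f.isEmbedding.injective (hp'.symm.trans hp)

end AlgebraicGeometry

open AlgebraicGeometry

/-- **Purity of affine immersions.**  Let `X → Y` be an affine immersion of schemes
with `Y` locally noetherian, let `X̄` be the closure of (the image of) `X` in `Y`
and suppose `X̄ \ X` is nonempty.  Then every irreducible component `Z` of `X̄ \ X`
has codimension exactly `1` in `X̄`: there is a strictly larger irreducible closed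
subset of `X̄` containing the closure of `Z`, but no chain of length two of such. -/
theorem irreducible_component_of_boundary_of_affine_immersion_codim_one
    {X Y : Scheme} (f : X ⟶ Y) [IsImmersion f] [IsAffineHom f]
    [IsLocallyNoetherian Y]
    (S : Set Y) (hS : S = Set.range f.base)
    (C : Set Y) (hC : C = closure S)
    (hne : (C \ S).Nonempty)
    (Z : Set Y) (hZsub : Z ⊆ C \ S) (hZirr : IsIrreducible Z)
    (hZmax : ∀ W : Set Y, W ⊆ C \ S → IsIrreducible W → Z ⊆ W → W = Z) :
    (∃ W : Set Y, IsIrreducible W ∧ IsClosed W ∧ W ⊆ C ∧ closure Z ⊂ W) ∧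
    ¬ ∃ W W' : Set Y, IsIrreducible W ∧ IsClosed W ∧ W ⊆ C ∧
        IsIrreducible W' ∧ IsClosed W' ∧ W' ⊆ C ∧
        closure Z ⊂ W ∧ W ⊂ W' := by
  subst hS hC
  have hloc : IsLocallyClosed (Set.range f) := f.isLocallyClosed_range
  have hclosed : IsClosed (closure (Set.range f) \ Set.range f) := by
    simpa [coborder] using hloc.isOpen_coborder.isClosed_compl
  have hZclosed : IsClosed Z := by
    rw [← hZmax (closure Z) (hclosed.closure_subset_iff.mpr hZsub) hZirr.closure subset_closure]
    exact isClosed_closure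
  rw [hZclosed.closure_eq]
  set z := hZirr.genericPoint
  have hzcl : closure {z} = Z := hZirr.closure_genericPoint hZclosed
  have hzZ : z ∈ Z := hzcl ▸ subset_closure rfl
  refine ⟨?_, ?_⟩
  · obtain ⟨U, hU, hzU, hUn⟩ := IsLocallyNoetherian.exists_isOpen_noetherianSpace z
    obtain ⟨T, hTS, hT, hzT⟩ :=
      exists_isIrreducible_subset_of_mem_closure hU hzU (hZsub hzZ).1
    refine ⟨closure T, hT.closure, isClosed_closure, closure_mono hTS, ?_, fun hle ↦ ?_⟩
    · rw [← hzcl]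
      exact closure_minimal (Set.singleton_subset_iff.mpr hzT) isClosed_closure
    · obtain ⟨t, ht⟩ := hT.nonempty
      exact (hZsub (hle (subset_closure ht))).2 (hTS ht)
  · rintro ⟨W, W', hW, hWc, hWC, hW', hWc', hWC', hZW, hWW'⟩
    have hmem : ∀ V : Set Y, (hV : IsIrreducible V) → IsClosed V → V ⊆ closure (Set.range f) →
        Z ⊂ V → hV.genericPoint ∈ Set.range f := by
      intro V hV hVc hVC hZV
      by_contra hcon
      have hvcl := hV.closure_genericPoint hVc
      have hv : hV.genericPoint ∈ closure (Set.range f) :=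
        hVC (hvcl.le (subset_closure (Set.mem_singleton _)))
      have hsub : V ⊆ closure (Set.range f) \ Set.range f := by
        rw [← hvcl]
        exact closure_minimal (Set.singleton_subset_iff.mpr ⟨hv, hcon⟩) hclosed
      exact hZV.ne (hZmax V hsub hV hZV.subset).symm
    obtain ⟨w, hw⟩ := hmem W hW hWc hWC hZW
    obtain ⟨w', hw'⟩ := hmem W' hW' hWc' hWC' (hZW.trans hWW')
    have hWcl := hW.closure_genericPoint hWc
    have hWcl' := hW'.closure_genericPoint hWc'
    rw [← hw] at hWcl
    rw [← hw'] at hWcl'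
    have heq := eq_of_specializes_of_isAffineHom_of_isImmersion f (hZsub hzZ).2
      (w := w) (w' := w') (fun y hy hyz ↦ ?_)
      (specializes_iff_mem_closure.mpr (hWcl ▸ hZW.subset hzZ))
      (specializes_iff_mem_closure.mpr (hWcl' ▸ hWW'.subset (hWcl ▸ subset_closure rfl)))
    · exact hWW'.ne (by rw [← hWcl, ← hWcl', heq])
    · have hycl : closure {y} = Z := by
        refine hZmax _ (closure_minimal (Set.singleton_subset_iff.mpr hy) hclosed)
          isIrreducible_singleton.closure ?_
        rw [← hzcl]
        exact closure_minimal (Set.singleton_subset_iff.mpr hyz.mem_closure) isClosed_closure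
      have : z ⤳ y := specializes_iff_mem_closure.mpr
        (by rw [hzcl, ← hycl]; exact subset_closure rfl)
      exact (hyz.antisymm this).eq
end

section
/- Let A be a commutative ring and F• = (0 → F⁰ → F¹ → ⋯ → F^m → 0) a bounded complex of finitely generated free A-modules with differentials d^i. For a prime s of A with residue field κ(s), dim_{κ(s)} H^n(F• ⊗_A κ(s)) = rank F^n − rank(d^n ⊗ κ(s)) − rank(d^{n−1} ⊗ κ(s)). The function s ↦ rank(d^i ⊗ κ(s)) is lower semi-continuous on Spec A (its sublevel sets {rank < r} are the closed zero loci of the r×r minors of d^i), hence s ↦ dim_{κ(s)} H^n(F• ⊗_A κ(s)) is upper semi-continuous, and s ↦ Σ_n (−1)^n dim_{κ(s)} H^n(F• ⊗ κ(s)) is locally constant. -/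
noncomputable section

open Matrix

variable {A : Type} [CommRing A]

/-- The residue field `κ(s)` at a point `s` of `Spec A`. -/
abbrev ResidueFieldAt (A : Type) [CommRing A] (s : PrimeSpectrum A) : Type :=
  FractionRing (A ⧸ s.asIdeal)

instance (s : PrimeSpectrum A) : IsDomain (A ⧸ s.asIdeal) := by
  haveI := s.isPrime; infer_instance

instance (s : PrimeSpectrum A) : Field (ResidueFieldAt A s) := by
  infer_instance

/-- The canonical ring map `A → κ(s)`. -/
def resMap (s : PrimeSpectrum A) : A →+* ResidueFieldAt A s :=
  (algebraMap (A ⧸ s.asIdeal) (FractionRing (A ⧸ s.asIdeal))).comp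
    (Ideal.Quotient.mk s.asIdeal)

variable {K : Type} [Field K]

/-- The dimension of the `n`-th cohomology of the complex of finite dimensional
`K`-vector spaces `0 → K^{r 0} → K^{r 1} → ⋯` with differentials given by the
matrices `d i : K^{r i} → K^{r (i+1)}`. -/
def cohomDim (r : ℕ → ℕ) (d : ∀ i : ℕ, Matrix (Fin (r (i + 1))) (Fin (r i)) K) :
    ℕ → ℕ
  | 0 => Module.finrank K (LinearMap.ker (Matrix.mulVecLin (d 0)))
  | (n + 1) =>
      Module.finrank K
        ((LinearMap.ker (Matrix.mulVecLin (d (n + 1)))) ⧸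
          (Submodule.comap (LinearMap.ker (Matrix.mulVecLin (d (n + 1)))).subtype
            (LinearMap.range (Matrix.mulVecLin (d n)))))

/-- Near each point, a lower semicontinuous `ℕ`-valued function is bounded below by its value. -/
theorem LowerSemicontinuous.eventually_le {X : Type*} [TopologicalSpace X] {f : X → ℕ}
    (hf : LowerSemicontinuous f) (x : X) : ∀ᶠ y in nhds x, f x ≤ f y := by
  rcases Nat.eq_zero_or_pos (f x) with h | h
  · simp [h]
  · filter_upwards [hf x (f x - 1) (by lia)] with y hy
    lia

/-- A matrix of rank at least `R` over a field has `R` linearly independent rows. -/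
theorem Matrix.exists_linearIndependent_rows {L ι κ : Type*} [Field L] [Finite ι] [Fintype κ]
    (M : Matrix ι κ L) {R : ℕ} (hR : R ≤ M.rank) :
    ∃ ρ : Fin R → ι, LinearIndependent L (M.submatrix ρ id).row := by
  obtain ⟨τ, a, ha, hspan, hli⟩ := exists_linearIndependent' L M.row
  have : Finite τ := Finite.of_injective a ha
  have := Fintype.ofFinite τ
  have hcard : R ≤ Fintype.card τ := by
    rwa [← finrank_span_eq_card hli, hspan, ← M.rank_eq_finrank_span_row]
  let e : Fin R → τ := (Fintype.equivFin τ).symm ∘ Fin.castLE hcard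
  have he : Function.Injective e :=
    (Fintype.equivFin τ).symm.injective.comp (Fin.castLE_injective hcard)
  exact ⟨a ∘ e, hli.comp e he⟩

/-- A matrix over a field has rank at least `R` iff some minor of size `R` is nonzero. -/
theorem Matrix.le_rank_iff_exists_minor_ne_zero {L ι κ : Type*} [Field L] [Finite ι] [Fintype κ]
    (M : Matrix ι κ L) (R : ℕ) :
    R ≤ M.rank ↔ ∃ (ρ : Fin R → ι) (γ : Fin R → κ), (M.submatrix ρ γ).det ≠ 0 := by
  constructor
  · intro hR
    obtain ⟨ρ, hρ⟩ := M.exists_linearIndependent_rows hR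
    have hrank : R ≤ (M.submatrix ρ id)ᵀ.rank := by
      rw [Matrix.rank_transpose, hρ.rank_matrix, Fintype.card_fin]
    obtain ⟨γ, hγ⟩ := (M.submatrix ρ id)ᵀ.exists_linearIndependent_rows hrank
    refine ⟨ρ, γ, ?_⟩
    have hunit := Matrix.linearIndependent_rows_iff_isUnit.mp hγ
    rw [Matrix.isUnit_iff_isUnit_det, ← Matrix.det_transpose] at hunit
    exact hunit.ne_zero
  · rintro ⟨ρ, γ, hdet⟩
    have h := Matrix.rank_of_det_ne_zero hdet
    rw [Fintype.card_fin] at h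
    exact h.symm.le.trans (M.rank_submatrix_le ρ γ)

theorem resMap_eq_zero_iff (s : PrimeSpectrum A) (a : A) : resMap s a = 0 ↔ a ∈ s.asIdeal := by
  rw [resMap, RingHom.comp_apply, ← Ideal.Quotient.eq_zero_iff_mem]
  exact IsFractionRing.to_map_eq_zero_iff

theorem finrank_ker_mulVecLin_add_rank {p q : ℕ} (M : Matrix (Fin p) (Fin q) K) :
    Module.finrank K (LinearMap.ker M.mulVecLin) + M.rank = q := by
  rw [Matrix.rank, add_comm, LinearMap.finrank_range_add_finrank_ker, Module.finrank_fin_fun]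

theorem cohomDim_zero_add_rank (r : ℕ → ℕ)
    (d : ∀ i : ℕ, Matrix (Fin (r (i + 1))) (Fin (r i)) K) :
    cohomDim r d 0 + (d 0).rank = r 0 :=
  finrank_ker_mulVecLin_add_rank (d 0)

theorem cohomDim_succ_add_rank (r : ℕ → ℕ)
    (d : ∀ i : ℕ, Matrix (Fin (r (i + 1))) (Fin (r i)) K) (n : ℕ)
    (h : d (n + 1) * d n = 0) :
    cohomDim r d (n + 1) + (d n).rank + (d (n + 1)).rank = r (n + 1) := by
  have hle : LinearMap.range (d n).mulVecLin ≤ LinearMap.ker (d (n + 1)).mulVecLin := by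
    rw [LinearMap.range_le_ker_iff, ← Matrix.mulVecLin_mul, h, Matrix.mulVecLin_zero]
  have hquot := Submodule.finrank_quotient_add_finrank
    (Submodule.comap (LinearMap.ker (d (n + 1)).mulVecLin).subtype
      (LinearMap.range (d n).mulVecLin))
  rw [(Submodule.comapSubtypeEquivOfLe hle).finrank_eq] at hquot
  have hker := finrank_ker_mulVecLin_add_rank (d (n + 1))
  rw [← hquot] at hker
  exact hker

/-- The Euler characteristic of the cohomology, truncated after degree `m`. -/
theorem sum_cohomDim (r : ℕ → ℕ) (d : ∀ i : ℕ, Matrix (Fin (r (i + 1))) (Fin (r i)) K)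
    (h : ∀ i, d (i + 1) * d i = 0) (m : ℕ) :
    ∑ n ∈ Finset.range (m + 1), (-1 : ℤ) ^ n * (cohomDim r d n : ℤ) =
      ∑ n ∈ Finset.range (m + 1), (-1 : ℤ) ^ n * (r n : ℤ) - (-1) ^ m * ((d m).rank : ℤ) := by
  induction m with
  | zero =>
    have h0 := cohomDim_zero_add_rank r d
    simp only [zero_add, Finset.sum_range_one, pow_zero, one_mul]
    omega
  | succ m ih =>
    have hm : (cohomDim r d (m + 1) + (d m).rank + (d (m + 1)).rank : ℤ) = r (m + 1) :=
      mod_cast cohomDim_succ_add_rank r d m (h m)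
    rw [Finset.sum_range_succ, ih, Finset.sum_range_succ _ (m + 1), ← hm]
    ring

theorem rank_resMap_lt_eq_zeroLocus {p q : ℕ} (M : Matrix (Fin p) (Fin q) A) (R : ℕ) :
    {s : PrimeSpectrum A | (M.map (resMap s)).rank < R} =
      PrimeSpectrum.zeroLocus
        {a : A | ∃ (ρ : Fin R → Fin p) (γ : Fin R → Fin q), a = (M.submatrix ρ γ).det} := by
  ext s
  have hminor (ρ : Fin R → Fin p) (γ : Fin R → Fin q) :
      ((M.map (resMap s)).submatrix ρ γ).det = 0 ↔ (M.submatrix ρ γ).det ∈ s.asIdeal := by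
    rw [← resMap_eq_zero_iff, RingHom.map_det]
    rfl
  rw [Set.mem_ofPred_eq, ← not_le, Matrix.le_rank_iff_exists_minor_ne_zero,
    PrimeSpectrum.mem_zeroLocus]
  push Not
  constructor
  · rintro h a ⟨ρ, γ, rfl⟩
    exact (hminor ρ γ).mp (h ρ γ)
  · intro h ρ γ
    exact (hminor ρ γ).mpr (h ⟨ρ, γ, rfl⟩)

theorem lowerSemicontinuous_rank_resMap {p q : ℕ} (M : Matrix (Fin p) (Fin q) A) :
    LowerSemicontinuous (fun s : PrimeSpectrum A => (M.map (resMap s)).rank) := by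
  intro s R hR
  have hclosed : IsClosed {t : PrimeSpectrum A | (M.map (resMap t)).rank < R + 1} := by
    rw [rank_resMap_lt_eq_zeroLocus]
    exact PrimeSpectrum.isClosed_zeroLocus _
  have hs : s ∈ {t : PrimeSpectrum A | (M.map (resMap t)).rank < R + 1}ᶜ :=
    fun h => (Nat.lt_succ_iff.mp h).not_gt hR
  filter_upwards [hclosed.isOpen_compl.mem_nhds hs] with t ht
  exact not_le.mp fun h => ht (Nat.lt_succ_of_le h)

/-- Let `F• = (0 → F⁰ → F¹ → ⋯ → F^m → 0)` be a bounded complex of finite free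
`A`-modules (encoded by matrices `d i`).  Then, for every point `s` of `Spec A` with
residue field `κ(s)`:
* `dim_{κ(s)} H^n(F• ⊗ κ(s)) = rank F^n − rank (dⁿ ⊗ κ(s)) − rank (dⁿ⁻¹ ⊗ κ(s))`;
* `s ↦ rank (dⁱ ⊗ κ(s))` is lower semi-continuous, its sublevel sets being the
  closed zero loci of the `R × R` minors of `dⁱ`;
* hence `s ↦ dim_{κ(s)} H^n(F• ⊗ κ(s))` is upper semi-continuous; and
* the Euler characteristic `s ↦ Σₙ (−1)ⁿ dim_{κ(s)} Hⁿ(F• ⊗ κ(s))` is locally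
  constant. -/
theorem perfect_complex_fiberwise_cohomology_semicontinuity
    (m : ℕ) (r : ℕ → ℕ) (hbdd : ∀ i, m < i → r i = 0)
    (d : ∀ i : ℕ, Matrix (Fin (r (i + 1))) (Fin (r i)) A)
    (hcomplex : ∀ i, d (i + 1) * d i = 0) :
    -- the rank formula for the fiberwise cohomology
    ((∀ s : PrimeSpectrum A,
        cohomDim r (fun i => (d i).map (resMap s)) 0 =
          r 0 - ((d 0).map (resMap s)).rank) ∧
      (∀ (s : PrimeSpectrum A) (n : ℕ),
        cohomDim r (fun i => (d i).map (resMap s)) (n + 1) =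
          r (n + 1) - ((d (n + 1)).map (resMap s)).rank
            - ((d n).map (resMap s)).rank)) ∧
    -- sublevel sets of the rank functions are zero loci of minors, and the rank
    -- functions are lower semi-continuous
    (∀ (i R : ℕ),
        {s : PrimeSpectrum A | ((d i).map (resMap s)).rank < R} =
          PrimeSpectrum.zeroLocus
            {a : A | ∃ (ρ : Fin R → Fin (r (i + 1))) (γ : Fin R → Fin (r i)),
              a = ((d i).submatrix ρ γ).det}) ∧
    (∀ i : ℕ,
        LowerSemicontinuous (fun s : PrimeSpectrum A => ((d i).map (resMap s)).rank)) ∧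
    -- upper semicontinuity of the fiberwise cohomology dimensions
    (∀ n : ℕ,
        UpperSemicontinuous
          (fun s : PrimeSpectrum A => cohomDim r (fun i => (d i).map (resMap s)) n)) ∧
    -- local constancy of the Euler characteristic
    IsLocallyConstant
      (fun s : PrimeSpectrum A =>
        ∑ n ∈ Finset.range (m + 1),
          (-1 : ℤ) ^ n * (cohomDim r (fun i => (d i).map (resMap s)) n : ℤ)) := by
  have hcomplex' (s : PrimeSpectrum A) (i : ℕ) :
      (d (i + 1)).map (resMap s) * (d i).map (resMap s) = 0 := by
    rw [← Matrix.map_mul, hcomplex, Matrix.map_zero _ (map_zero _)]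
  have hzero (s : PrimeSpectrum A) :=
    cohomDim_zero_add_rank r (fun i => (d i).map (resMap s))
  have hsucc (s : PrimeSpectrum A) (n : ℕ) :=
    cohomDim_succ_add_rank r (fun i => (d i).map (resMap s)) n (hcomplex' s n)
  refine ⟨⟨fun s => ?_, fun s n => ?_⟩, fun i R => rank_resMap_lt_eq_zeroLocus (d i) R,
    fun i => lowerSemicontinuous_rank_resMap (d i), fun n => ?_, ?_⟩
  · exact Nat.eq_sub_of_add_eq (hzero s)
  · have := hsucc s n
    lia
  · cases n with
    | zero =>
      intro s y hy
      have hrank := (lowerSemicontinuous_rank_resMap (d 0)).eventually_le s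
      filter_upwards [hrank] with t ht
      have hs := hzero s
      have ht' := hzero t
      lia
    | succ n =>
      intro s y hy
      have hrank := (lowerSemicontinuous_rank_resMap (d n)).eventually_le s
      have hrank' := (lowerSemicontinuous_rank_resMap (d (n + 1))).eventually_le s
      filter_upwards [hrank, hrank'] with t ht ht'
      have hs := hsucc s n
      have hst := hsucc t n
      lia
  · refine (IsLocallyConstant.iff_exists_open _).mpr fun s => ⟨Set.univ, isOpen_univ, trivial, ?_⟩
    intro t _
    have hlast (u : PrimeSpectrum A) : ((d m).map (resMap u)).rank = 0 := by
      have := Matrix.rank_le_height ((d m).map (resMap u))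
      have := hbdd (m + 1) m.lt_succ_self
      lia
    rw [sum_cohomDim r _ (hcomplex' t), sum_cohomDim r _ (hcomplex' s), hlast, hlast]

end
end
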